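/- arXiv:1310.0503 — 2 statements merged into one kernel-verified Lean document; each statement's English description precedes it below -/
import Mathlib

section
/- Let L be a Lie ring whose center Z(L) has finite index. If the abelian group L/Z(L) has rank n and exponent e, then L² = [L,L] is finite, has rank at most n(n-1)/2, and its exponent divides e. -/
/-- Lemma 7 of Eick–Horn–Zandi: Let `L` be a Lie ring whose
center `Z(L)` has finite index. If the additive group `L/Z(L)` is generated by
`n` elements and has exponent `e`, then the derived subring `L² = ⁅L, L⁆` is
finite, is generated (as additive group) by at most `n(n-1)/2` elements, and
its exponent divides `e`. -/
theorem derived_finite_of_center_finite_index {L : Type*} [LieRing L] (n e : ℕ)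
    (hfin : Finite (L ⧸ LieAlgebra.center ℤ L))
    (hrank : ∃ S : Finset (L ⧸ LieAlgebra.center ℤ L),
      S.card = n ∧ AddSubgroup.closure (S : Set (L ⧸ LieAlgebra.center ℤ L)) = ⊤)
    (hexp : AddMonoid.exponent (L ⧸ LieAlgebra.center ℤ L) = e) :
    Finite ↥(⁅(⊤ : LieIdeal ℤ L), (⊤ : LieIdeal ℤ L)⁆ : LieIdeal ℤ L) ∧
    (∃ T : Finset ↥(⁅(⊤ : LieIdeal ℤ L), (⊤ : LieIdeal ℤ L)⁆ : LieIdeal ℤ L),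
      T.card ≤ n * (n - 1) / 2 ∧
      AddSubgroup.closure (T : Set ↥(⁅(⊤ : LieIdeal ℤ L), (⊤ : LieIdeal ℤ L)⁆ :
        LieIdeal ℤ L)) = ⊤) ∧
    AddMonoid.exponent
      ↥(⁅(⊤ : LieIdeal ℤ L), (⊤ : LieIdeal ℤ L)⁆ : LieIdeal ℤ L) ∣ e := by
  classical
  obtain ⟨S, hSn, hS⟩ := hrank
  set D : LieIdeal ℤ L := ⁅(⊤ : LieIdeal ℤ L), (⊤ : LieIdeal ℤ L)⁆ with hD
  have hbr : ∀ a b : L, ⁅a, b⁆ ∈ D := fun a b =>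
    LieSubmodule.lie_mem_lie (LieSubmodule.mem_top a) (LieSubmodule.mem_top b)
  have hspan : ∀ K : AddSubgroup L, (∀ a b : L, ⁅a, b⁆ ∈ K) → ∀ d ∈ D, d ∈ K := by
    intro K hK d hd
    have h1 : d ∈ LieSubmodule.toSubmodule D := hd
    rw [hD, LieSubmodule.lieIdeal_oper_eq_linear_span'] at h1
    have h2 : Submodule.span ℤ {x | ∃ a ∈ (⊤ : LieIdeal ℤ L), ∃ b ∈ (⊤ : LieIdeal ℤ L),
        ⁅a, b⁆ = x} ≤ AddSubgroup.toIntSubmodule K := by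
      rw [Submodule.span_le]
      rintro _ ⟨a, -, b, -, rfl⟩
      exact hK a b
    exact h2 h1
  have hcen : ∀ z ∈ LieAlgebra.center ℤ L, ∀ b : L, ⁅z, b⁆ = 0 := by
    intro z hz b
    have h := (LieModule.mem_maxTrivSubmodule (R := ℤ) (L := L) (M := L) z).1 hz b
    rw [← lie_skew, h, neg_zero]
  have he : e ≠ 0 := by
    rw [← hexp]
    exact AddMonoid.exponent_ne_zero_of_finite
  have hexpD : ∀ d : D, e • d = 0 := by
    rintro ⟨d, hd⟩
    have := hspan (nsmulAddMonoidHom (α := L) e).ker (by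
      intro a b
      have hz : e • a ∈ LieAlgebra.center ℤ L := by
        rw [← LieSubmodule.Quotient.mk_eq_zero']
        have h := AddMonoid.exponent_nsmul_eq_zero
          (LieSubmodule.Quotient.mk a : L ⧸ LieAlgebra.center ℤ L)
        rw [hexp] at h
        exact h
      have h2 := hcen _ hz b
      rw [nsmul_lie] at h2
      simpa [AddMonoidHom.mem_ker] using h2) d hd
    apply Subtype.ext
    simpa [AddMonoidHom.mem_ker] using this
  have hT : ∃ T : Finset D, T.card ≤ n * (n - 1) / 2 ∧
      AddSubgroup.closure (T : Set D) = ⊤ := by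
    let eq : Fin n ≃ S := (S.equivFinOfCardEq hSn).symm
    have hsurj : ∀ q : L ⧸ LieAlgebra.center ℤ L, ∃ a : L, LieSubmodule.Quotient.mk a = q :=
      fun q => Quotient.exists_rep q
    choose r hr using hsurj
    let x : Fin n → L := fun i => r (eq i)
    let f : (Σ i : Fin n, Fin i) → D := fun s => ⟨⁅x s.1, x ⟨s.2, s.2.2.trans s.1.2⟩⁆, hbr _ _⟩
    refine ⟨Finset.univ.image f, ?_, ?_⟩
    · refine Finset.card_image_le.trans ?_
      rw [Finset.card_univ, Fintype.card_sigma]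
      simp only [Fintype.card_fin]
      rw [Fin.sum_univ_eq_sum_range (fun i => i) n, Finset.sum_range_id]
    · set C := AddSubgroup.closure ((Finset.univ.image f : Finset D) : Set D) with hC
      let K : AddSubgroup L := C.map (LieSubmodule.toSubmodule D).subtype.toAddMonoidHom
      have hlt : ∀ i j : Fin n, j < i → ⁅x i, x j⁆ ∈ K := by
        intro i j hij
        refine ⟨f ⟨i, ⟨j, hij⟩⟩, AddSubgroup.subset_closure ?_, rfl⟩
        exact Finset.mem_coe.2 (Finset.mem_image_of_mem f (Finset.mem_univ _))
      have hgen : ∀ i j, ⁅x i, x j⁆ ∈ K := by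
        intro i j
        rcases lt_trichotomy i j with h | h | h
        · rw [← lie_skew]
          exact K.neg_mem (hlt _ _ h)
        · rw [h, lie_self]
          exact K.zero_mem
        · exact hlt _ _ h
      have hind : ∀ P : AddSubgroup L, (∀ i, x i ∈ P) →
          (∀ z ∈ LieAlgebra.center ℤ L, z ∈ P) → ∀ a, a ∈ P := by
        intro P hx hz a
        have key : ∀ q : L ⧸ LieAlgebra.center ℤ L,
            ∃ p ∈ P, (LieSubmodule.Quotient.mk p : L ⧸ LieAlgebra.center ℤ L) = q := by
          intro q
          have hq : q ∈ AddSubgroup.closure (S : Set (L ⧸ LieAlgebra.center ℤ L)) := by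
            rw [hS]; trivial
          induction hq using AddSubgroup.closure_induction with
          | mem q hq =>
            refine ⟨x (eq.symm ⟨q, hq⟩), hx _, ?_⟩
            simp [x, hr]
          | zero => exact ⟨0, P.zero_mem, rfl⟩
          | add a b _ _ ha hb =>
            obtain ⟨p, hp, rfl⟩ := ha
            obtain ⟨p', hp', rfl⟩ := hb
            exact ⟨p + p', P.add_mem hp hp', rfl⟩
          | neg a _ ha =>
            obtain ⟨p, hp, rfl⟩ := ha
            exact ⟨-p, P.neg_mem hp, rfl⟩
        obtain ⟨p, hp, hpa⟩ := key (LieSubmodule.Quotient.mk a)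
        have h3 : p - a ∈ LieAlgebra.center ℤ L := (Submodule.Quotient.eq _).1 hpa
        have h4 := P.sub_mem hp (hz _ h3)
        simpa using h4
      have hK : ∀ a b : L, ⁅a, b⁆ ∈ K := by
        have step : ∀ b : L, (∀ i, ⁅x i, b⁆ ∈ K) → ∀ a : L, ⁅a, b⁆ ∈ K := by
          intro b hb a
          let φ : L →+ L := AddMonoidHom.mk' (fun a => ⁅a, b⁆) (fun a a' => add_lie a a' b)
          refine hind (K.comap φ) hb ?_ a
          intro z hz
          change ⁅z, b⁆ ∈ K
          rw [hcen z hz b]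
          exact K.zero_mem
        intro a b
        refine step b (fun i => ?_) a
        rw [← lie_skew]
        exact K.neg_mem (step (x i) (fun j => hgen j i) b)
      rw [eq_top_iff]
      rintro ⟨d, hd⟩ -
      obtain ⟨c, hc, hcd⟩ := hspan K hK d hd
      have hcd2 : (c : L) = d := hcd
      subst hcd2
      exact hc
  refine ⟨?_, hT, AddMonoid.exponent_dvd_of_forall_nsmul_eq_zero hexpD⟩
  obtain ⟨T, -, hTc⟩ := hT
  have : AddGroup.FG D := ⟨⟨T, hTc⟩⟩
  exact AddCommGroup.finite_of_fg_torsion D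
    (fun d => isOfFinAddOrder_iff_nsmul_eq_zero.2 ⟨e, Nat.pos_of_ne_zero he, hexpD d⟩)
end

section
/- Let L = F/R be a finite Lie ring, where F is a free Lie ring and R an ideal of F. Then H²(L,ℂ*) ≅ (F² ∩ R)/[F,R], and in particular H²(L,ℂ*) is finite. -/
/-- The five cocycle conditions of Horn–Zandi for a pair `(f, g)` of maps `L × L → A`,
where `L` is a Lie ring and `A` a trivial `L`-module (an abelian group). -/
def IsLieRingCocycle {L A : Type*} [LieRing L] [AddCommGroup A]
    (f g : L → L → A) : Prop :=
  (∀ x y z : L, f (x + y) z = f x z + f y z + g ⁅x, z⁆ ⁅y, z⁆) ∧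
  (∀ x y z : L, f x (y + z) = f x y + f x z + g ⁅x, y⁆ ⁅x, z⁆) ∧
  (∀ x : L, f x x = 0) ∧
  (∀ x y z : L, f x ⁅y, z⁆ + f z ⁅x, y⁆ + f y ⁅z, x⁆ =
    - g ⁅x, ⁅y, z⁆⁆ ⁅z, ⁅x, y⁆⁆ - g (-⁅y, ⁅z, x⁆⁆) ⁅y, ⁅z, x⁆⁆) ∧
  (∀ x y z : L, g (x + y) z + g x y = g x (y + z) + g y z) ∧
  (∀ x y : L, g x y = g y x)

/-- Coboundaries: pairs arising from a map `t : L → A` with `t 0 = 0` via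
`f (x, y) = -t ⁅x, y⁆` and `g (x, y) = t x + t y - t (x + y)`. -/
def IsLieRingCoboundary {L A : Type*} [LieRing L] [AddCommGroup A]
    (f g : L → L → A) : Prop :=
  ∃ t : L → A, t 0 = 0 ∧ (∀ x y : L, f x y = - t ⁅x, y⁆) ∧
    (∀ x y : L, g x y = t x + t y - t (x + y))

def lieZ2 (L A : Type*) [LieRing L] [AddCommGroup A] :
    AddSubgroup ((L → L → A) × (L → L → A)) where
  carrier := {p | IsLieRingCocycle p.1 p.2}
  zero_mem' := by
    refine ⟨?_, ?_, ?_, ?_, ?_, ?_⟩ <;> intros <;> simp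
  add_mem' := by
    intro p q hp hq
    obtain ⟨h1, h2, h3, h4, h5, h6⟩ := hp
    obtain ⟨h1', h2', h3', h4', h5', h6'⟩ := hq
    refine ⟨fun x y z => ?_, fun x y z => ?_, fun x => ?_, fun x y z => ?_,
      fun x y z => ?_, fun x y => ?_⟩ <;>
      simp only [Prod.fst_add, Prod.snd_add, Pi.add_apply]
    · rw [h1, h1']; abel
    · rw [h2, h2']; abel
    · rw [h3, h3']; abel
    · calc p.1 x ⁅y, z⁆ + q.1 x ⁅y, z⁆ + (p.1 z ⁅x, y⁆ + q.1 z ⁅x, y⁆) +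
            (p.1 y ⁅z, x⁆ + q.1 y ⁅z, x⁆)
          = (p.1 x ⁅y, z⁆ + p.1 z ⁅x, y⁆ + p.1 y ⁅z, x⁆) +
            (q.1 x ⁅y, z⁆ + q.1 z ⁅x, y⁆ + q.1 y ⁅z, x⁆) := by abel
        _ = (- p.2 ⁅x, ⁅y, z⁆⁆ ⁅z, ⁅x, y⁆⁆ - p.2 (-⁅y, ⁅z, x⁆⁆) ⁅y, ⁅z, x⁆⁆) +
            (- q.2 ⁅x, ⁅y, z⁆⁆ ⁅z, ⁅x, y⁆⁆ - q.2 (-⁅y, ⁅z, x⁆⁆) ⁅y, ⁅z, x⁆⁆) := by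
              rw [h4, h4']
        _ = _ := by abel
    · calc p.2 (x + y) z + q.2 (x + y) z + (p.2 x y + q.2 x y)
          = (p.2 (x + y) z + p.2 x y) + (q.2 (x + y) z + q.2 x y) := by abel
        _ = (p.2 x (y + z) + p.2 y z) + (q.2 x (y + z) + q.2 y z) := by rw [h5, h5']
        _ = _ := by abel
    · rw [h6, h6']
  neg_mem' := by
    intro p hp
    obtain ⟨h1, h2, h3, h4, h5, h6⟩ := hp
    refine ⟨fun x y z => ?_, fun x y z => ?_, fun x => ?_, fun x y z => ?_,
      fun x y z => ?_, fun x y => ?_⟩ <;>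
      simp only [Prod.fst_neg, Prod.snd_neg, Pi.neg_apply]
    · rw [h1]; abel
    · rw [h2]; abel
    · rw [h3]; abel
    · rw [← neg_add, ← neg_add, h4]; abel
    · rw [← neg_add, ← neg_add, h5]
    · rw [h6]

def lieB2 (L A : Type*) [LieRing L] [AddCommGroup A] :
    AddSubgroup (lieZ2 L A) where
  carrier := {p | IsLieRingCoboundary p.val.1 p.val.2}
  zero_mem' := ⟨0, by simp, by simp, by simp⟩
  add_mem' := by
    rintro p q ⟨t, ht0, htf, htg⟩ ⟨s, hs0, hsf, hsg⟩
    refine ⟨t + s, by simp [ht0, hs0], fun x y => ?_, fun x y => ?_⟩ <;>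
      simp only [AddSubgroup.coe_add, Prod.fst_add, Prod.snd_add, Pi.add_apply,
        htf, hsf, htg, hsg] <;> abel
  neg_mem' := by
    rintro p ⟨t, ht0, htf, htg⟩
    refine ⟨-t, by simp [ht0], fun x y => ?_, fun x y => ?_⟩ <;>
      simp only [AddSubgroup.coe_neg, Prod.fst_neg, Prod.snd_neg, Pi.neg_apply,
        htf, htg] <;> abel

/-- Second Lie ring cohomology of `L` with coefficients in the trivial module `A`. -/
def lieH2 (L A : Type*) [LieRing L] [AddCommGroup A] :=
  lieZ2 L A ⧸ lieB2 L A

instance (L A : Type*) [LieRing L] [AddCommGroup A] : AddCommGroup (lieH2 L A) :=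
  QuotientAddGroup.Quotient.addCommGroup _

/-- The additive group underlying the Lie ideal `F² ∩ R = ⁅F, F⁆ ⊓ R` of the
free Lie ring `F` on `X`. -/
noncomputable def derivedInterAdd {X : Type*} (R : LieIdeal ℤ (FreeLieAlgebra ℤ X)) :
    AddSubgroup (FreeLieAlgebra ℤ X) :=
  ((⁅(⊤ : LieIdeal ℤ (FreeLieAlgebra ℤ X)),
      (⊤ : LieIdeal ℤ (FreeLieAlgebra ℤ X))⁆ ⊓ R :
    LieIdeal ℤ (FreeLieAlgebra ℤ X)) :
      Submodule ℤ (FreeLieAlgebra ℤ X)).toAddSubgroup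

/-- The additive group underlying the Lie ideal `[F, R] = ⁅F, R⁆` of the free
Lie ring `F` on `X`. -/
noncomputable def bracketFRAdd {X : Type*} (R : LieIdeal ℤ (FreeLieAlgebra ℤ X)) :
    AddSubgroup (FreeLieAlgebra ℤ X) :=
  ((⁅(⊤ : LieIdeal ℤ (FreeLieAlgebra ℤ X)), R⁆ :
    LieIdeal ℤ (FreeLieAlgebra ℤ X)) :
      Submodule ℤ (FreeLieAlgebra ℤ X)).toAddSubgroup

/-! ### The central extension attached to a cocycle -/

namespace LieExt

section Cocycle

variable {L A : Type*} [LieRing L] [AddCommGroup A] {f g : L → L → A}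

theorem g_zero_zero (hc : IsLieRingCocycle f g) : g 0 0 = 0 := by
  have h := hc.1 0 0 0
  have h3 := hc.2.2.1 0
  simp only [add_zero, lie_zero, h3, zero_add] at h
  exact h.symm

theorem g_right_zero (hc : IsLieRingCocycle f g) (x : L) : g x 0 = 0 := by
  have h := hc.2.2.2.2.1 x 0 0
  simp only [add_zero, g_zero_zero hc] at h
  simpa using h

theorem f_right_zero (hc : IsLieRingCocycle f g) (x : L) : f x 0 = 0 := by
  have h := hc.2.1 x 0 0
  simp only [add_zero, lie_zero, g_zero_zero hc] at h
  simpa using h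

/-- Carrier of the central extension. -/
@[ext]
structure Ext (c : lieZ2 L A) where
  /-- base component -/
  base : L
  /-- fibre component -/
  fib : A

variable (c : lieZ2 L A)

instance : Add (Ext c) := ⟨fun p q => ⟨p.base + q.base, p.fib + q.fib + c.1.2 p.base q.base⟩⟩
instance : Zero (Ext c) := ⟨⟨0, 0⟩⟩
instance : Neg (Ext c) := ⟨fun p => ⟨-p.base, -p.fib - c.1.2 (-p.base) p.base⟩⟩
instance : Bracket (Ext c) (Ext c) := ⟨fun p q => ⟨⁅p.base, q.base⁆, c.1.1 p.base q.base⟩⟩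

@[simp] theorem add_base (p q : Ext c) : (p + q).base = p.base + q.base := rfl
@[simp] theorem add_fib (p q : Ext c) :
    (p + q).fib = p.fib + q.fib + c.1.2 p.base q.base := rfl
@[simp] theorem zero_base : (0 : Ext c).base = 0 := rfl
@[simp] theorem zero_fib : (0 : Ext c).fib = 0 := rfl
@[simp] theorem neg_base (p : Ext c) : (-p).base = -p.base := rfl
@[simp] theorem neg_fib (p : Ext c) : (-p).fib = -p.fib - c.1.2 (-p.base) p.base := rfl
@[simp] theorem lie_base (p q : Ext c) : ⁅p, q⁆.base = ⁅p.base, q.base⁆ := rfl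
@[simp] theorem lie_fib (p q : Ext c) : ⁅p, q⁆.fib = c.1.1 p.base q.base := rfl

instance : AddCommGroup (Ext c) where
  add_assoc p q r := by
    ext
    · simp [add_assoc]
    · have h := c.2.2.2.2.2.1 p.base q.base r.base
      simp only [add_fib, add_base]
      calc _ = p.fib + q.fib + r.fib +
            (c.1.2 (p.base + q.base) r.base + c.1.2 p.base q.base) := by abel
        _ = _ := by rw [h]; abel
  zero_add p := by
    ext
    · simp
    · simp [c.2.2.2.2.2.2 0 p.base, g_right_zero c.2]
  add_zero p := by
    ext
    · simp
    · simp [g_right_zero c.2]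
  nsmul := nsmulRec
  zsmul := zsmulRec
  neg_add_cancel p := by
    ext
    · simp
    · simp only [add_fib, neg_fib, neg_base, zero_fib]; abel
  add_comm p q := by
    ext
    · simp [add_comm]
    · simp only [add_fib, c.2.2.2.2.2.2 p.base q.base]; abel

theorem leibniz_of_jacobi {E : Type*} [AddCommGroup E] [Bracket E E]
    (h1 : ∀ x y z : E, ⁅x + y, z⁆ = ⁅x, z⁆ + ⁅y, z⁆)
    (h2 : ∀ x y z : E, ⁅x, y + z⁆ = ⁅x, y⁆ + ⁅x, z⁆)
    (h3 : ∀ x : E, ⁅x, x⁆ = 0)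
    (h4 : ∀ x y z : E, ⁅x, ⁅y, z⁆⁆ + ⁅z, ⁅x, y⁆⁆ + ⁅y, ⁅z, x⁆⁆ = 0) (x y z : E) :
    ⁅x, ⁅y, z⁆⁆ = ⁅⁅x, y⁆, z⁆ + ⁅y, ⁅x, z⁆⁆ := by
  have sk : ∀ a b : E, ⁅a, b⁆ = -⁅b, a⁆ := by
    intro a b
    have h := h3 (a + b)
    rw [h1, h2, h2, h3, h3] at h
    simp only [zero_add, add_zero] at h
    exact eq_neg_of_add_eq_zero_left h
  have z0 : ∀ a : E, ⁅a, (0 : E)⁆ = 0 := by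
    intro a
    have h := h2 a 0 0
    simpa using h
  have ng : ∀ a b : E, ⁅a, -b⁆ = -⁅a, b⁆ := by
    intro a b
    have h := h2 a b (-b)
    rw [add_neg_cancel, z0] at h
    exact (neg_eq_of_add_eq_zero_right h.symm).symm
  have h := h4 x y z
  rw [sk z x, ng, sk z ⁅x, y⁆] at h
  have h' : ⁅x, ⁅y, z⁆⁆ - (⁅⁅x, y⁆, z⁆ + ⁅y, ⁅x, z⁆⁆) = 0 := by
    rw [← h]; abel
  exact sub_eq_zero.mp h'

theorem jac {L : Type*} [LieRing L] (x y z : L) :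
    ⁅x, ⁅y, z⁆⁆ + ⁅z, ⁅x, y⁆⁆ + ⁅y, ⁅z, x⁆⁆ = 0 := by
  have := lie_jacobi x y z
  rw [← this]; abel

theorem jac' {L : Type*} [LieRing L] (x y z : L) :
    ⁅x, ⁅y, z⁆⁆ + ⁅z, ⁅x, y⁆⁆ = -⁅y, ⁅z, x⁆⁆ :=
  eq_neg_of_add_eq_zero_left (jac x y z)

instance : LieRing (Ext c) :=
  have h1 : ∀ x y z : Ext c, ⁅x + y, z⁆ = ⁅x, z⁆ + ⁅y, z⁆ := by
    intro x y z
    ext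
    · simp
    · simp [c.2.1]
  have h2 : ∀ x y z : Ext c, ⁅x, y + z⁆ = ⁅x, y⁆ + ⁅x, z⁆ := by
    intro x y z
    ext
    · simp
    · simp [c.2.2.1]
  have h3 : ∀ x : Ext c, ⁅x, x⁆ = 0 := by
    intro x
    ext
    · simp
    · simp [c.2.2.2.1]
  { add_lie := h1
    lie_add := h2
    lie_self := h3
    leibniz_lie := leibniz_of_jacobi h1 h2 h3 (by
      intro x y z
      ext
      · simpa using jac x.base y.base z.base
      · have h := c.2.2.2.2.1 x.base y.base z.base
        simp only [add_fib, lie_fib, lie_base, add_base, zero_fib, jac']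
        calc _ = (c.1.1 x.base ⁅y.base, z.base⁆ + c.1.1 z.base ⁅x.base, y.base⁆ +
                c.1.1 y.base ⁅z.base, x.base⁆) +
                c.1.2 ⁅x.base, ⁅y.base, z.base⁆⁆ ⁅z.base, ⁅x.base, y.base⁆⁆ +
                c.1.2 (-⁅y.base, ⁅z.base, x.base⁆⁆) ⁅y.base, ⁅z.base, x.base⁆⁆ := by abel
          _ = 0 := by rw [h]; abel) }

end Cocycle

/-! ### Primitives of cocycles on the free Lie ring -/

section Prim

variable {F L A : Type*} [LieRing F] [LieRing L] [AddCommGroup A]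

/-- `h` trivialises the pullback of `(f, g)` along `π`. -/
def IsPrim (π : F → L) (p : (L → L → A) × (L → L → A)) (h : F → A) : Prop :=
  (∀ u v, h (u + v) = h u + h v + p.2 (π u) (π v)) ∧ (∀ u v, h ⁅u, v⁆ = p.1 (π u) (π v))

theorem IsPrim.add {π : F → L} {p q : (L → L → A) × (L → L → A)} {h k : F → A}
    (hh : IsPrim π p h) (hk : IsPrim π q k) : IsPrim π (p + q) (h + k) := by
  refine ⟨fun u v => ?_, fun u v => ?_⟩
  · simp only [Pi.add_apply, Prod.snd_add, hh.1, hk.1]; abel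
  · simp only [Pi.add_apply, Prod.fst_add, hh.2, hk.2]

/-- A function with a primitive property on a surjection comes from a cocycle. -/
theorem IsPrim.cocycle {π : F → L} (hs : Function.Surjective π)
    (ha : ∀ u v, π (u + v) = π u + π v) (hl : ∀ u v, π ⁅u, v⁆ = ⁅π u, π v⁆)
    {p : (L → L → A) × (L → L → A)} {h : F → A}
    (hh : IsPrim π p h) (h0 : h 0 = 0) : p ∈ lieZ2 L A := by
  obtain ⟨hg, hf⟩ := hh
  refine ⟨?_, ?_, ?_, ?_, ?_, ?_⟩
  · intro x y z
    obtain ⟨u, rfl⟩ := hs x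
    obtain ⟨v, rfl⟩ := hs y
    obtain ⟨w, rfl⟩ := hs z
    rw [← ha, ← hf, ← hf, ← hf, ← hl, ← hl, add_lie, hg]
  · intro x y z
    obtain ⟨u, rfl⟩ := hs x
    obtain ⟨v, rfl⟩ := hs y
    obtain ⟨w, rfl⟩ := hs z
    rw [← ha, ← hf, ← hf, ← hf, ← hl, ← hl, lie_add, hg]
  · intro x
    obtain ⟨u, rfl⟩ := hs x
    rw [← hf, lie_self, h0]
  · intro x y z
    obtain ⟨u, rfl⟩ := hs x
    obtain ⟨v, rfl⟩ := hs y
    obtain ⟨w, rfl⟩ := hs z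
    rw [← jac']
    simp only [← hl, ← hf, ← ha]
    have e1 := hg ⁅u, ⁅v, w⁆⁆ ⁅w, ⁅u, v⁆⁆
    have e2 := hg (⁅u, ⁅v, w⁆⁆ + ⁅w, ⁅u, v⁆⁆) ⁅v, ⁅w, u⁆⁆
    rw [jac, h0, e1] at e2
    rw [← sub_eq_zero]
    refine Eq.trans ?_ e2.symm
    abel
  · intro x y z
    obtain ⟨u, rfl⟩ := hs x
    obtain ⟨v, rfl⟩ := hs y
    obtain ⟨w, rfl⟩ := hs z
    have e1 := hg (u + v) w
    have e2 := hg u (v + w)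
    rw [hg u v] at e1
    rw [hg v w, ← add_assoc u v w, e1] at e2
    rw [← ha, ← ha]
    have : h u + h v + h w + (p.2 (π (u + v)) (π w) + p.2 (π u) (π v))
        = h u + h v + h w + (p.2 (π u) (π (v + w)) + p.2 (π v) (π w)) := by
      calc _ = h u + h v + p.2 (π u) (π v) + h w + p.2 (π (u + v)) (π w) := by abel
        _ = _ := by rw [e2]; abel
    exact add_left_cancel this
  · intro x y
    obtain ⟨u, rfl⟩ := hs x
    obtain ⟨v, rfl⟩ := hs y
    have e1 := hg u v
    have e2 := hg v u
    rw [add_comm v u, e1, add_comm (h v)] at e2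
    exact add_left_cancel e2

end Prim

section Free

variable {X : Type*} (R : LieIdeal ℤ (FreeLieAlgebra ℤ X)) {A : Type*} [AddCommGroup A]


/-- The projection. -/
noncomputable def pr (u : FreeLieAlgebra ℤ X) : FreeLieAlgebra ℤ X ⧸ R := LieSubmodule.Quotient.mk u

theorem pr_add (u v : (FreeLieAlgebra ℤ X)) : pr R (u + v) = pr R u + pr R v := rfl
theorem pr_sub (u v : (FreeLieAlgebra ℤ X)) : pr R (u - v) = pr R u - pr R v := rfl
theorem pr_zero : pr R 0 = 0 := rfl
theorem pr_lie (u v : (FreeLieAlgebra ℤ X)) : pr R ⁅u, v⁆ = ⁅pr R u, pr R v⁆ := rfl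
theorem pr_surj : Function.Surjective (pr R) := LieSubmodule.Quotient.surjective_mk' R
theorem pr_eq_zero {u : (FreeLieAlgebra ℤ X)} : pr R u = 0 ↔ u ∈ R := LieSubmodule.Quotient.mk_eq_zero'

theorem exists_prim (c : lieZ2 ((FreeLieAlgebra ℤ X) ⧸ R) A) : ∃ h : (FreeLieAlgebra ℤ X) → A, IsPrim (pr R) c.1 h := by
  let φ : (FreeLieAlgebra ℤ X) →ₗ⁅ℤ⁆ Ext c := FreeLieAlgebra.lift ℤ (fun x => ⟨pr R (FreeLieAlgebra.of ℤ x), 0⟩)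
  let b : Ext c →+ ((FreeLieAlgebra ℤ X) ⧸ R) := { toFun := Ext.base, map_zero' := rfl, map_add' := fun _ _ => rfl }
  let β : Ext c →ₗ⁅ℤ⁆ ((FreeLieAlgebra ℤ X) ⧸ R) :=
    { toFun := Ext.base
      map_add' := fun _ _ => rfl
      map_smul' := fun n x => by
        have := map_intCast_smul b ℤ ℤ n x
        simp only [Int.cast_id] at this
        exact this
      map_lie' := fun {_ _} => rfl }
  let ρ : (FreeLieAlgebra ℤ X) →ₗ⁅ℤ⁆ ((FreeLieAlgebra ℤ X) ⧸ R) :=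
    { toFun := pr R
      map_add' := fun _ _ => rfl
      map_smul' := fun n x => rfl
      map_lie' := fun {_ _} => rfl }
  have e : β.comp φ = ρ := by
    apply FreeLieAlgebra.hom_ext
    intro x
    change (φ (FreeLieAlgebra.of ℤ x)).base = pr R (FreeLieAlgebra.of ℤ x)
    exact congrArg Ext.base (FreeLieAlgebra.lift_of_apply
      (fun x => (⟨pr R (FreeLieAlgebra.of ℤ x), 0⟩ : Ext c)) x)
  have e' : ∀ u, (φ u).base = pr R u := fun u => LieHom.congr_fun e u
  refine ⟨fun u => (φ u).fib, fun u v => ?_, fun u v => ?_⟩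
  · simp only [map_add, add_fib, e']
  · simp only [LieHom.map_lie, lie_fib, e']

theorem mem_of_bracket (I J : LieIdeal ℤ (FreeLieAlgebra ℤ X)) (S : AddSubgroup (FreeLieAlgebra ℤ X))
    (h : ∀ u ∈ I, ∀ v ∈ J, ⁅u, v⁆ ∈ S) {x : (FreeLieAlgebra ℤ X)} (hx : x ∈ ⁅I, J⁆) : x ∈ S := by
  rw [← LieSubmodule.mem_toSubmodule, LieSubmodule.lieIdeal_oper_eq_linear_span'] at hx
  induction hx using Submodule.span_induction with
  | mem x hx =>
    obtain ⟨u, hu, v, hv, rfl⟩ := hx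
    exact h u hu v hv
  | zero => exact S.zero_mem
  | add x y _ _ hx hy => exact S.add_mem hx hy
  | smul a x _ hx =>
    have := S.zsmul_mem hx a
    simpa using this

theorem mem_derived {x : (FreeLieAlgebra ℤ X)} : x ∈ derivedInterAdd R ↔
    x ∈ ⁅(⊤ : LieIdeal ℤ (FreeLieAlgebra ℤ X)), (⊤ : LieIdeal ℤ (FreeLieAlgebra ℤ X))⁆ ∧ x ∈ R := Iff.rfl

theorem mem_FR {x : (FreeLieAlgebra ℤ X)} : x ∈ bracketFRAdd R ↔ x ∈ ⁅(⊤ : LieIdeal ℤ (FreeLieAlgebra ℤ X)), R⁆ := Iff.rfl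

theorem prim_zero {c : lieZ2 ((FreeLieAlgebra ℤ X) ⧸ R) A} {h : (FreeLieAlgebra ℤ X) → A} (hh : IsPrim (pr R) c.1 h) : h 0 = 0 := by
  have := hh.2 0 0
  rwa [lie_self, c.2.2.2.1] at this

theorem prim_unique {p : ((FreeLieAlgebra ℤ X) ⧸ R → (FreeLieAlgebra ℤ X) ⧸ R → A) × ((FreeLieAlgebra ℤ X) ⧸ R → (FreeLieAlgebra ℤ X) ⧸ R → A)} {h k : (FreeLieAlgebra ℤ X) → A}
    (hh : IsPrim (pr R) p h) (hk : IsPrim (pr R) p k) {x : (FreeLieAlgebra ℤ X)}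
    (hx : x ∈ ⁅(⊤ : LieIdeal ℤ (FreeLieAlgebra ℤ X)), (⊤ : LieIdeal ℤ (FreeLieAlgebra ℤ X))⁆) : h x = k x := by
  let d : (FreeLieAlgebra ℤ X) →+ A := AddMonoidHom.mk' (fun u => h u - k u) (by
    intro u v
    rw [hh.1, hk.1]; abel)
  have : x ∈ d.ker := by
    refine mem_of_bracket ⊤ ⊤ d.ker (fun u _ v _ => ?_) hx
    change h _ - k _ = 0
    rw [hh.2, hk.2, sub_self]
  exact sub_eq_zero.mp this

/-- Restriction of a primitive to `R`. -/
noncomputable def primR {c : lieZ2 ((FreeLieAlgebra ℤ X) ⧸ R) A} {h : (FreeLieAlgebra ℤ X) → A} (hh : IsPrim (pr R) c.1 h) :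
    R.toSubmodule.toAddSubgroup →+ A :=
  AddMonoidHom.mk' (fun u => h u) (by
    intro u v
    have hu : pr R (u : (FreeLieAlgebra ℤ X)) = 0 := (pr_eq_zero R).2 u.2
    have hv : pr R (v : (FreeLieAlgebra ℤ X)) = 0 := (pr_eq_zero R).2 v.2
    change h ((u : (FreeLieAlgebra ℤ X)) + v) = _
    rw [hh.1, hu, hv, g_zero_zero c.2, add_zero])

theorem prim_FR {c : lieZ2 ((FreeLieAlgebra ℤ X) ⧸ R) A} {h : (FreeLieAlgebra ℤ X) → A} (hh : IsPrim (pr R) c.1 h) {x : (FreeLieAlgebra ℤ X)}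
    (hx : x ∈ ⁅(⊤ : LieIdeal ℤ (FreeLieAlgebra ℤ X)), R⁆) : h x = 0 := by
  have : x ∈ (primR R hh).ker.map (AddSubgroup.subtype _) := by
    refine mem_of_bracket ⊤ R _ (fun u _ v hv => ?_) hx
    refine ⟨⟨⁅u, v⁆, R.lie_mem hv⟩, ?_, rfl⟩
    change h ⁅u, v⁆ = 0
    rw [hh.2, (pr_eq_zero R).2 hv, f_right_zero c.2]
  obtain ⟨y, hy, rfl⟩ := this
  exact hy

/-- The Schur multiplier. -/
abbrev Mult := ↥(derivedInterAdd R) ⧸ (bracketFRAdd R).addSubgroupOf (derivedInterAdd R)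

/-- The character attached to a primitive. -/
noncomputable def primM {c : lieZ2 ((FreeLieAlgebra ℤ X) ⧸ R) A} {h : (FreeLieAlgebra ℤ X) → A} (hh : IsPrim (pr R) c.1 h) : Mult R →+ A :=
  QuotientAddGroup.lift _ ((primR R hh).comp
    (AddSubgroup.inclusion (show derivedInterAdd R ≤ R.toSubmodule.toAddSubgroup from
      fun _ hx => hx.2))) (by
    intro x hx
    exact prim_FR R hh hx)

theorem primM_mk {c : lieZ2 ((FreeLieAlgebra ℤ X) ⧸ R) A} {h : (FreeLieAlgebra ℤ X) → A} (hh : IsPrim (pr R) c.1 h)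
    (x : derivedInterAdd R) : primM R hh (QuotientAddGroup.mk x) = h x := rfl

/-- The comparison map. -/
noncomputable def comparison : lieZ2 ((FreeLieAlgebra ℤ X) ⧸ R) A →+ (Mult R →+ A) :=
  AddMonoidHom.mk' (fun c => primM R (exists_prim R c).choose_spec) (by
    intro c d
    ext x
    exact prim_unique R (exists_prim R (c + d)).choose_spec
      ((exists_prim R c).choose_spec.add (exists_prim R d).choose_spec) x.2.1)

theorem comparison_mk {c : lieZ2 ((FreeLieAlgebra ℤ X) ⧸ R) A} {h : (FreeLieAlgebra ℤ X) → A} (hh : IsPrim (pr R) c.1 h)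
    (x : derivedInterAdd R) : comparison R c (QuotientAddGroup.mk x) = h x :=
  prim_unique R (exists_prim R c).choose_spec hh x.2.1

theorem exists_extend (hA : Module.Baer ℤ A) {N G : Type*} [AddCommGroup N] [AddCommGroup G]
    (i : N →+ G) (φ : N →+ A) (hk : ∀ x, i x = 0 → φ x = 0) :
    ∃ ψ : G →+ A, ∀ x, ψ (i x) = φ x := by
  obtain ⟨ψ, hψ⟩ := hA.extension_property_addMonoidHom (QuotientAddGroup.kerLift i)
    (QuotientAddGroup.kerLift_injective i) (QuotientAddGroup.lift i.ker φ hk)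
  exact ⟨ψ, fun x => DFunLike.congr_fun hψ (QuotientAddGroup.mk x)⟩

theorem comparison_surj (hA : Module.Baer ℤ A) :
    Function.Surjective (comparison (A := A) R) := by
  intro χ
  obtain ⟨θ, hθ⟩ := exists_extend hA (derivedInterAdd R).subtype
    (χ.comp (QuotientAddGroup.mk' _)) (by
      intro x hx
      have : x = 0 := Subtype.ext hx
      simp [this])
  have hθ' : ∀ x ∈ ⁅(⊤ : LieIdeal ℤ (FreeLieAlgebra ℤ X)), R⁆, θ x = 0 := by
    intro x hx
    have hd : x ∈ derivedInterAdd R :=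
      ⟨LieSubmodule.mono_lie_right ⊤ (le_top : R ≤ ⊤) hx, LieSubmodule.lie_le_right R ⊤ hx⟩
    have := hθ ⟨x, hd⟩
    refine this.trans ?_
    have h0 : (QuotientAddGroup.mk' ((bracketFRAdd R).addSubgroupOf (derivedInterAdd R)))
        ⟨x, hd⟩ = 0 := (QuotientAddGroup.eq_zero_iff _).2 hx
    rw [AddMonoidHom.comp_apply, h0, map_zero]
  obtain ⟨s, hs, s0⟩ : ∃ s : (FreeLieAlgebra ℤ X) ⧸ R → (FreeLieAlgebra ℤ X), (∀ x, pr R (s x) = x) ∧ s 0 = 0 := by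
    classical
    refine ⟨fun x => if x = 0 then 0 else (pr_surj R x).choose, fun x => ?_, by simp⟩
    by_cases hx : x = 0
    · simp [hx, pr_zero]
    · simp only [hx, if_false]
      exact (pr_surj R x).choose_spec
  have hsr : ∀ u, u - s (pr R u) ∈ R := fun u => by
    rw [← pr_eq_zero, pr_sub, hs, sub_self]
  let p : ((FreeLieAlgebra ℤ X) ⧸ R → (FreeLieAlgebra ℤ X) ⧸ R → A) × ((FreeLieAlgebra ℤ X) ⧸ R → (FreeLieAlgebra ℤ X) ⧸ R → A) :=
    (fun x y => θ (⁅s x, s y⁆ - s ⁅x, y⁆), fun x y => θ (s x + s y - s (x + y)))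
  let h : (FreeLieAlgebra ℤ X) → A := fun u => θ (u - s (pr R u))
  have hp : IsPrim (pr R) p h := by
    refine ⟨fun u v => ?_, fun u v => ?_⟩
    · simp only [h, p, pr_add, ← map_add]
      congr 1; abel
    · simp only [h, p, pr_lie]
      rw [← sub_eq_zero, ← map_sub]
      apply hθ'
      have : ⁅u, v⁆ - s ⁅pr R u, pr R v⁆ - (⁅s (pr R u), s (pr R v)⁆ - s ⁅pr R u, pr R v⁆)
          = ⁅u, v - s (pr R v)⁆ - ⁅s (pr R v), u - s (pr R u)⁆ := by
        rw [lie_sub, lie_sub, ← lie_skew u (s (pr R v)),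
          ← lie_skew (s (pr R u)) (s (pr R v))]
        abel
      rw [this]
      exact sub_mem (LieSubmodule.lie_mem_lie (LieSubmodule.mem_top _) (hsr v))
        (LieSubmodule.lie_mem_lie (LieSubmodule.mem_top _) (hsr u))
  have h0 : h 0 = 0 := by simp [h, pr_zero, s0]
  have hz := hp.cocycle (pr_surj R) (pr_add R) (pr_lie R) h0
  refine ⟨⟨p, hz⟩, ?_⟩
  ext x
  refine (comparison_mk R (c := ⟨p, hz⟩) hp x).trans ?_
  change θ _ = _
  rw [(pr_eq_zero R).2 x.2.2, s0, sub_zero]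
  exact hθ x

theorem comparison_ker (hA : Module.Baer ℤ A) :
    (comparison (A := A) R).ker = lieB2 ((FreeLieAlgebra ℤ X) ⧸ R) A := by
  ext c
  constructor
  · intro hc
    obtain ⟨h, hh⟩ := exists_prim R c
    let D : AddSubgroup (FreeLieAlgebra ℤ X) :=
      (⁅(⊤ : LieIdeal ℤ (FreeLieAlgebra ℤ X)), (⊤ : LieIdeal ℤ (FreeLieAlgebra ℤ X))⁆ : LieIdeal ℤ (FreeLieAlgebra ℤ X)).toSubmodule.toAddSubgroup
    obtain ⟨ψ, hψ⟩ := exists_extend hA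
      ((QuotientAddGroup.mk' D).comp (R.toSubmodule.toAddSubgroup).subtype) (primR R hh) (by
        intro x hx
        have hxD : (x : (FreeLieAlgebra ℤ X)) ∈ D := (QuotientAddGroup.eq_zero_iff _).1 hx
        have := comparison_mk R hh ⟨x, hxD, x.2⟩
        rw [show comparison R c = 0 from hc] at this
        exact this.symm)
    let k : (FreeLieAlgebra ℤ X) → A := fun u => h u - ψ (QuotientAddGroup.mk' D u)
    have hk : IsPrim (pr R) c.1 k := by
      refine ⟨fun u v => ?_, fun u v => ?_⟩
      · simp only [k, hh.1, map_add]; abel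
      · have : (QuotientAddGroup.mk' D) ⁅u, v⁆ = 0 := (QuotientAddGroup.eq_zero_iff _).2
          (LieSubmodule.lie_mem_lie (LieSubmodule.mem_top _) (LieSubmodule.mem_top _))
        simp only [k, hh.2, this, map_zero, sub_zero]
    have hkR : ∀ r ∈ R, k r = 0 := by
      intro r hr
      exact sub_eq_zero.2 (hψ ⟨r, hr⟩).symm
    have hkc : ∀ u v, pr R u = pr R v → k u = k v := by
      intro u v huv
      have hm : u - v ∈ R := by rw [← pr_eq_zero, pr_sub, huv, sub_self]
      have := hk.1 v (u - v)
      rwa [add_sub_cancel, hkR _ hm, (pr_eq_zero R).2 hm, g_right_zero c.2, add_zero,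
        add_zero] at this
    choose s hs using pr_surj R
    refine ⟨fun x => - k (s x), ?_, fun x y => ?_, fun x y => ?_⟩
    · beta_reduce
      rw [hkR _ ((pr_eq_zero R).1 (hs 0)), neg_zero]
    · rw [neg_neg, hkc (s ⁅x, y⁆) ⁅s x, s y⁆ (by rw [pr_lie, hs, hs, hs]), hk.2, hs, hs]
    · have := hk.1 (s x) (s y)
      rw [hs, hs] at this
      beta_reduce
      rw [hkc (s (x + y)) (s x + s y) (by rw [pr_add, hs, hs, hs]), this]
      abel
  · rintro ⟨t, t0, tf, tg⟩
    have hp : IsPrim (pr R) c.1 (fun u => - t (pr R u)) := by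
      refine ⟨fun u v => ?_, fun u v => ?_⟩
      · beta_reduce; rw [tg, pr_add]; abel
      · beta_reduce; rw [tf, pr_lie]
    change comparison R c = 0
    ext x
    refine (comparison_mk R hp x).trans ?_
    rw [(pr_eq_zero R).2 x.2.2, t0, neg_zero]
    rfl

/-- The Hopf formula with divisible coefficients. -/
noncomputable def hopf (hA : Module.Baer ℤ A) : lieH2 ((FreeLieAlgebra ℤ X) ⧸ R) A ≃+ (Mult R →+ A) :=
  (QuotientAddGroup.quotientAddEquivOfEq (comparison_ker R hA).symm).trans
    (QuotientAddGroup.quotientKerEquivOfSurjective _ (comparison_surj R hA))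

theorem finite_mult (hfin : Finite ((FreeLieAlgebra ℤ X) ⧸ R)) : Finite (Mult R) := by
  let q := QuotientAddGroup.mk' (bracketFRAdd R)
  choose s hs using pr_surj R
  let S : Set ((FreeLieAlgebra ℤ X) ⧸ bracketFRAdd R) :=
    Set.range (fun z : ((FreeLieAlgebra ℤ X) ⧸ R) × ((FreeLieAlgebra ℤ X) ⧸ R) => q ⁅s z.1, s z.2⁆)
  have hq : ∀ u v : (FreeLieAlgebra ℤ X), v ∈ R → q ⁅u, v⁆ = 0 := fun u v hv => (QuotientAddGroup.eq_zero_iff _).2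
    (LieSubmodule.lie_mem_lie (LieSubmodule.mem_top _) hv)
  have hq' : ∀ u v : (FreeLieAlgebra ℤ X), v ∈ R → q ⁅v, u⁆ = 0 := fun u v hv => by
    rw [← lie_skew, map_neg, hq u v hv, neg_zero]
  have hmem : ∀ u v : (FreeLieAlgebra ℤ X), q ⁅u, v⁆ ∈ S := by
    intro u v
    refine ⟨(pr R u, pr R v), ?_⟩
    have hu : u - s (pr R u) ∈ R := by rw [← pr_eq_zero, pr_sub, hs, sub_self]
    have hv : v - s (pr R v) ∈ R := by rw [← pr_eq_zero, pr_sub, hs, sub_self]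
    have h1 := hq u _ hv
    have h2 := hq' (s (pr R v)) _ hu
    rw [lie_sub, map_sub, sub_eq_zero] at h1
    rw [sub_lie, map_sub, sub_eq_zero] at h2
    exact (h1.trans h2).symm
  have hS : S.Finite := Set.finite_range _
  let T := AddSubgroup.closure S
  have htor : ∀ x ∈ T, Nat.card ((FreeLieAlgebra ℤ X) ⧸ R) • x = 0 := by
    intro x hx
    induction hx using AddSubgroup.closure_induction with
    | mem x hx =>
      obtain ⟨z, rfl⟩ := hx
      change _ • q _ = 0
      rw [← map_nsmul, ← nsmul_lie]
      apply hq'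
      rw [← pr_eq_zero]
      let prh : (FreeLieAlgebra ℤ X) →+ ((FreeLieAlgebra ℤ X) ⧸ R) := AddMonoidHom.mk' (pr R) (pr_add R)
      have : pr R (Nat.card ((FreeLieAlgebra ℤ X) ⧸ R) • s z.1) = Nat.card ((FreeLieAlgebra ℤ X) ⧸ R) • pr R (s z.1) :=
        map_nsmul prh _ _
      rw [this, card_nsmul_eq_zero']
    | zero => simp
    | add x y _ _ hx hy => rw [nsmul_add, hx, hy, add_zero]
    | neg x _ hx => rw [neg_nsmul, hx, neg_zero]
  have : AddGroup.FG T := by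
    rw [AddGroup.fg_iff_addSubgroup_fg]
    exact ⟨hS.toFinset, by simp [T]⟩
  have hT : Finite T := by
    refine AddCommGroup.finite_of_fg_torsion T ?_
    intro x
    rw [isOfFinAddOrder_iff_nsmul_eq_zero]
    exact ⟨Nat.card ((FreeLieAlgebra ℤ X) ⧸ R), Nat.card_pos, Subtype.ext (htor x x.2)⟩
  have hDT : ∀ x ∈ ⁅(⊤ : LieIdeal ℤ (FreeLieAlgebra ℤ X)), (⊤ : LieIdeal ℤ (FreeLieAlgebra ℤ X))⁆, q x ∈ T := fun x hx =>
    mem_of_bracket ⊤ ⊤ (T.comap q)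
      (fun u _ v _ => AddSubgroup.subset_closure (hmem u v)) hx
  let j : derivedInterAdd R →+ T :=
    (q.comp (derivedInterAdd R).subtype).codRestrict T (fun x => hDT x x.2.1)
  have hj : j.ker = (bracketFRAdd R).addSubgroupOf (derivedInterAdd R) := by
    ext x
    rw [AddMonoidHom.mem_ker, Subtype.ext_iff]
    exact QuotientAddGroup.eq_zero_iff _
  have : Finite (↥(derivedInterAdd R) ⧸ j.ker) :=
    Finite.of_injective _ (QuotientAddGroup.kerLift_injective j)
  rw [hj] at this
  exact this

theorem baer_units : Module.Baer ℤ (Additive ℂˣ) := by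
  have hr : ∀ {n : ℕ}, n ≠ 0 → Function.Surjective (fun a : Additive ℂˣ => n • a) := by
    intro n hn a
    obtain ⟨z, hz⟩ := IsAlgClosed.exists_pow_nat_eq ((Additive.toMul a : ℂˣ) : ℂ)
      (Nat.pos_of_ne_zero hn)
    have hz0 : z ≠ 0 := by
      rintro rfl
      rw [zero_pow hn] at hz
      exact (Additive.toMul a).ne_zero hz.symm
    refine ⟨Additive.ofMul (Units.mk0 z hz0), ?_⟩
    apply Additive.toMul.injective
    ext
    simpa using hz
  have : DivisibleBy (Additive ℂˣ) ℕ := divisibleByOfSMulRightSurj _ _ hr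
  have : DivisibleBy (Additive ℂˣ) ℤ := AddGroup.divisibleByIntOfDivisibleByNat _
  exact Module.Baer.of_divisible _

theorem dual_equiv (M : Type*) [AddCommGroup M] [Finite M] :
    Nonempty ((M →+ Additive ℂˣ) ≃+ M) := by
  obtain ⟨e⟩ := CommGroup.monoidHom_mulEquiv_of_hasEnoughRootsOfUnity (Multiplicative M) ℂ
  refine ⟨AddEquiv.mk' ((AddMonoidHom.toMultiplicativeLeft (α := M) (β := ℂˣ)).trans (e.toEquiv.trans Multiplicative.toAdd)) ?_⟩
  intro a b
  exact map_mul e (AddMonoidHom.toMultiplicativeLeft a) (AddMonoidHom.toMultiplicativeLeft b)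

end Free

end LieExt

/-- Theorem 2 / Theorem 6.5, Hopf formula for second cohomology:
Let `L = F/R` be a finite Lie ring, where `F` is a free Lie ring (the free Lie
algebra over `ℤ` on a set `X`) and `R` an ideal of `F`. Then
`H²(L, ℂ*) ≅ (F² ∩ R)/[F, R]` as abelian groups, and in particular
`H²(L, ℂ*)` is finite. Here `ℂ*` is the multiplicative group of nonzero
complex numbers regarded as the trivial coefficient module `Additive ℂˣ`. -/
theorem lieH2_eq_schur_multiplier {X : Type*}
    (R : LieIdeal ℤ (FreeLieAlgebra ℤ X))
    (hfin : Finite (FreeLieAlgebra ℤ X ⧸ R)) :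
    Nonempty
      (lieH2 (FreeLieAlgebra ℤ X ⧸ R) (Additive ℂˣ) ≃+
        (↥(derivedInterAdd R) ⧸
          (bracketFRAdd R).addSubgroupOf (derivedInterAdd R))) ∧
    Finite (lieH2 (FreeLieAlgebra ℤ X ⧸ R) (Additive ℂˣ)) := by
  have hM := LieExt.finite_mult R hfin
  obtain ⟨e⟩ := LieExt.dual_equiv (LieExt.Mult R)
  let E := (LieExt.hopf R LieExt.baer_units).trans e
  exact ⟨⟨E⟩, Finite.of_injective E E.injective⟩
end
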